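/- arXiv:1703.10362 — 2 statements merged into one kernel-verified Lean document; each statement's English description precedes it below -/
import Mathlib

section
/- Let a, b be real numbers with 0 < a < 1, 0 < b < 1 and a ≠ b. Then πi + 2ψ(1) − ψ(a) − ψ(b) − ab·₄F₃(a+1, b+1, 1, 1; 2, 2, 2; 1) = a⁻¹·C_{a,b}·e^{πia}·₃F₂(a, a, a; 1+a−b, a+1; 1) + b⁻¹·C_{b,a}·e^{πib}·₃F₂(b, b, b; 1−a+b, b+1; 1), where all the hypergeometric series occurring converge (this is the value at t = 0, i.e. z = (1−t)⁻¹ = 1, of Zudilin's connection identity). -/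
set_option autoImplicit false

open Complex
open scoped Real

/-- Pochhammer symbol `(a)_n = a(a+1)⋯(a+n−1)` for a complex number. -/
noncomputable def pochC (a : ℂ) (n : ℕ) : ℂ := ∏ k ∈ Finset.range n, (a + k)

/-- Generalized hypergeometric series `₄F₃(a₁,a₂,a₃,a₄;b₁,b₂,b₃;x)`. -/
noncomputable def hyp4F3 (a₁ a₂ a₃ a₄ b₁ b₂ b₃ x : ℂ) : ℂ :=
  ∑' n : ℕ, (pochC a₁ n * pochC a₂ n * pochC a₃ n * pochC a₄ n) /
    (pochC b₁ n * pochC b₂ n * pochC b₃ n * (n.factorial : ℂ)) * x ^ n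

/-- Generalized hypergeometric series `₃F₂(a₁,a₂,a₃;b₁,b₂;x)`. -/
noncomputable def hyp3F2 (a₁ a₂ a₃ b₁ b₂ x : ℂ) : ℂ :=
  ∑' n : ℕ, (pochC a₁ n * pochC a₂ n * pochC a₃ n) /
    (pochC b₁ n * pochC b₂ n * (n.factorial : ℂ)) * x ^ n

/-- The digamma function `ψ(x) = Γ'(x)/Γ(x)` for real `x`. -/
noncomputable def digamma (x : ℝ) : ℝ := deriv Real.Gamma x / Real.Gamma x

/-- `C_{a,b} = Γ(b−a)/(Γ(1−a)Γ(b))`. -/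
noncomputable def Cab (a b : ℝ) : ℂ :=
  Complex.Gamma ((b : ℂ) - a) / (Complex.Gamma (1 - (a : ℂ)) * Complex.Gamma (b : ℂ))

section

open Filter Topology

/-- The coefficient `(b)_n / n!` of `xⁿ` in the expansion of `(1 - x)^(-b)`. -/
noncomputable def binCoef (b : ℝ) (n : ℕ) : ℝ := (∏ k ∈ Finset.range n, (b + k)) / n.factorial

lemma binCoef_zero (b : ℝ) : binCoef b 0 = 1 := by simp [binCoef]

lemma binCoef_succ (b : ℝ) (n : ℕ) : binCoef b (n + 1) = binCoef b n * (b + n) / (n + 1) := by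
  have h : (n.factorial : ℝ) ≠ 0 := by positivity
  rw [binCoef, binCoef, Finset.prod_range_succ, Nat.factorial_succ]
  push_cast
  field_simp

lemma binCoef_nonneg {b : ℝ} (hb : 0 < b) (n : ℕ) : 0 ≤ binCoef b n := by
  unfold binCoef
  positivity

lemma binCoef_eq_choose (b : ℝ) (n : ℕ) : binCoef b n = Ring.choose (b + n - 1) n := by
  rw [← Ring.multichoose_eq, binCoef, div_eq_iff (by positivity), mul_comm, ← nsmul_eq_mul,
    Ring.factorial_nsmul_multichoose_eq_ascPochhammer]
  rw [Polynomial.ascPochhammer_smeval_eq_eval]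
  induction n with
  | zero => simp
  | succ n ih => rw [Finset.prod_range_succ, ih, ascPochhammer_succ_eval]

lemma hasSum_binCoef_mul_pow (b : ℝ) {x : ℝ} (hx0 : 0 ≤ x) (hx1 : x < 1) :
    HasSum (fun n ↦ binCoef b n * x ^ n) ((1 - x) ^ (-b)) := by
  have h := (Real.one_div_one_sub_rpow_hasFPowerSeriesOnBall_zero b).hasSum (y := x)
    (by simpa [enorm_eq_nnnorm, ← NNReal.coe_lt_coe, abs_of_nonneg hx0] using hx1)
  simp only [FormalMultilinearSeries.ofScalars_apply_eq, zero_add, smul_eq_mul] at h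
  rw [Real.rpow_neg (by linarith), ← one_div]
  simpa only [binCoef_eq_choose] using h

lemma summable_binCoef_div_succ {b : ℝ} (hb0 : 0 < b) (hb1 : b < 1) :
    Summable (fun n : ℕ ↦ binCoef b n / (n + 1)) := by
  have key : ∀ N, ∑ n ∈ Finset.range N, (1 - b) * (binCoef b n / (n + 1)) = 1 - binCoef b N := by
    intro N
    induction N with
    | zero => simp [binCoef_zero]
    | succ N ih =>
      rw [Finset.sum_range_succ, ih, binCoef_succ]
      field_simp
      ring
  have h : Summable (fun n : ℕ ↦ (1 - b) * (binCoef b n / (n + 1))) := by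
    refine summable_of_sum_range_le (c := 1) (fun n ↦ ?_) (fun N ↦ ?_)
    · have := binCoef_nonneg hb0 n
      have : 0 < 1 - b := by linarith
      positivity
    · rw [key]
      linarith [binCoef_nonneg hb0 N]
  exact (summable_mul_left_iff (by linarith)).1 h

lemma summable_binCoef_div {b c : ℝ} (hb0 : 0 < b) (hb1 : b < 1) (hc : 0 < c) :
    Summable (fun n : ℕ ↦ binCoef b n / (n + c)) := by
  refine Summable.of_nonneg_of_le (fun n ↦ ?_) (fun n ↦ ?_)
    ((summable_binCoef_div_succ hb0 hb1).mul_left (1 + 1 / c))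
  · have := binCoef_nonneg hb0 n
    positivity
  · have := binCoef_nonneg hb0 n
    rw [mul_div_assoc', div_le_div_iff₀ (by positivity) (by positivity)]
    have : (1 + 1 / c) * binCoef b n * (n + c) - binCoef b n * (n + 1)
      = binCoef b n * (c + n / c) := by field_simp; ring
    have : 0 ≤ binCoef b n * (c + n / c) := by positivity
    linarith

lemma setIntegral_rpow_mul_one_sub_rpow {u v : ℝ} (hu : 0 < u) (hv : 0 < v) :
    ∫ x in Set.Ioo (0 : ℝ) 1, x ^ (u - 1) * (1 - x) ^ (v - 1) =
      Real.Gamma u * Real.Gamma v / Real.Gamma (u + v) := by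
  rw [← Complex.ofReal_inj, ← MeasureTheory.integral_Ioc_eq_integral_Ioo, ← integral_complex_ofReal,
    ← intervalIntegral.integral_of_le zero_le_one]
  have h := Complex.betaIntegral_eq_Gamma_mul_div (u : ℂ) (v : ℂ) (by simpa) (by simpa)
  rw [Complex.betaIntegral] at h
  push_cast
  rw [← Complex.Gamma_ofReal, ← Complex.Gamma_ofReal, ← Complex.Gamma_ofReal, Complex.ofReal_add,
    ← h]
  refine intervalIntegral.integral_congr fun x hx ↦ ?_
  rw [Set.uIcc_of_le zero_le_one] at hx
  rw [Complex.ofReal_cpow hx.1, Complex.ofReal_cpow (by linarith [hx.2])]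
  push_cast
  rfl

lemma hasSum_binCoef_div {b c : ℝ} (hb0 : 0 < b) (hb1 : b < 1) (hc : 0 < c) :
    HasSum (fun n : ℕ ↦ binCoef b n / (n + c))
      (Real.Gamma (1 - b) * Real.Gamma c / Real.Gamma (c + 1 - b)) := by
  have hint : ∀ n : ℕ, ∫ x in Set.Ioo (0 : ℝ) 1, binCoef b n * x ^ ((n : ℝ) + c - 1) =
      binCoef b n / (n + c) := by
    intro n
    rw [MeasureTheory.integral_const_mul, ← MeasureTheory.integral_Ioc_eq_integral_Ioo,
      ← intervalIntegral.integral_of_le zero_le_one, integral_rpow (Or.inl _)]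
    · have : (n : ℝ) + c ≠ 0 := by positivity
      simp [Real.zero_rpow this, div_eq_mul_inv]
    · have : (0 : ℝ) ≤ n := by positivity
      linarith
  have h := MeasureTheory.hasSum_integral_of_summable_integral_norm
    (μ := MeasureTheory.volume.restrict (Set.Ioo (0 : ℝ) 1))
    (F := fun (n : ℕ) (x : ℝ) ↦ binCoef b n * x ^ ((n : ℝ) + c - 1)) ?_ ?_
  · simp only [hint] at h
    suffices e : Real.Gamma (1 - b) * Real.Gamma c / Real.Gamma (c + 1 - b) =
        ∫ x in Set.Ioo (0 : ℝ) 1, ∑' n : ℕ, binCoef b n * x ^ ((n : ℝ) + c - 1) by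
      rw [e]
      exact h
    rw [mul_comm, show c + 1 - b = c + (1 - b) by ring,
      ← setIntegral_rpow_mul_one_sub_rpow hc (by linarith)]
    refine MeasureTheory.setIntegral_congr_fun measurableSet_Ioo fun x hx ↦ ?_
    have hs := ((hasSum_binCoef_mul_pow b hx.1.le hx.2).mul_left (x ^ (c - 1))).tsum_eq
    rw [show 1 - b - 1 = -b by ring, ← hs]
    refine tsum_congr fun n ↦ ?_
    rw [show (n : ℝ) + c - 1 = (c - 1) + n by ring, Real.rpow_add hx.1, Real.rpow_natCast]
    ring
  · intro n
    refine MeasureTheory.Integrable.const_mul ?_ _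
    refine MeasureTheory.IntegrableOn.mono_set (t := Set.Ioc (0 : ℝ) 1) ?_ Set.Ioo_subset_Ioc_self
    rw [← intervalIntegrable_iff_integrableOn_Ioc_of_le zero_le_one]
    refine intervalIntegral.intervalIntegrable_rpow' ?_
    have : (0 : ℝ) ≤ n := by positivity
    linarith
  · refine (summable_binCoef_div hb0 hb1 hc).congr fun n ↦ ?_
    rw [← hint n]
    refine MeasureTheory.setIntegral_congr_fun measurableSet_Ioo fun x hx ↦ ?_
    have := binCoef_nonneg hb0 n
    have := hx.1
    rw [Real.norm_of_nonneg (by positivity)]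

lemma binCoef_succ_le {b : ℝ} (hb0 : 0 < b) (hb1 : b < 1) (n : ℕ) :
    binCoef b (n + 1) ≤ binCoef b n := by
  have := binCoef_nonneg hb0 n
  rw [binCoef_succ, div_le_iff₀ (by positivity)]
  exact mul_le_mul_of_nonneg_left (by linarith) this

lemma summable_binCoef_succ_div {b : ℝ} (hb0 : 0 < b) (hb1 : b < 1) :
    Summable (fun n : ℕ ↦ binCoef b (n + 1) / (n + 1)) := by
  refine Summable.of_nonneg_of_le (fun n ↦ ?_) (fun n ↦ ?_) (summable_binCoef_div_succ hb0 hb1)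
  · have := binCoef_nonneg hb0 (n + 1)
    positivity
  · have := binCoef_succ_le hb0 hb1 n
    gcongr

lemma hasDerivAt_realGamma {s : ℝ} (hs : 0 < s) :
    HasDerivAt Real.Gamma (_root_.digamma s * Real.Gamma s) s := by
  have h : DifferentiableAt ℝ Real.Gamma s :=
    Real.differentiableAt_Gamma fun m ↦ ((neg_nonpos.mpr m.cast_nonneg).trans_lt hs).ne'
  have e : _root_.digamma s * Real.Gamma s = deriv Real.Gamma s :=
    div_mul_cancel₀ _ (Real.Gamma_pos_of_pos hs).ne'
  rw [e]
  exact h.hasDerivAt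

lemma hasDerivAt_Gamma_div_Gamma {c d : ℝ} (hc : 0 < c) (hd : 0 < c - d) :
    HasDerivAt (fun s ↦ Real.Gamma s / Real.Gamma (s - d))
      ((_root_.digamma c - _root_.digamma (c - d)) * (Real.Gamma c / Real.Gamma (c - d))) c := by
  have hne := (Real.Gamma_pos_of_pos hd).ne'
  have h2 : HasDerivAt (fun s ↦ Real.Gamma (s - d))
      (_root_.digamma (c - d) * Real.Gamma (c - d)) c :=
    HasDerivAt.comp_sub_const c d (hasDerivAt_realGamma hd)
  refine ((hasDerivAt_realGamma hc).div h2 hne).congr_deriv ?_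
  field_simp

lemma hasSum_binCoef_succ_div_add {b c : ℝ} (hb0 : 0 < b) (hb1 : b < 1) (hc : 0 < c) :
    HasSum (fun n : ℕ ↦ binCoef b (n + 1) / (n + 1 + c))
      (Real.Gamma (1 - b) * Real.Gamma c / Real.Gamma (c + 1 - b) - 1 / c) := by
  have h := (hasSum_nat_add_iff' 1).2 (hasSum_binCoef_div hb0 hb1 hc)
  simpa [binCoef_zero] using h

lemma tsum_binCoef_succ_div {b : ℝ} (hb0 : 0 < b) (hb1 : b < 1) :
    ∑' n : ℕ, binCoef b (n + 1) / (n + 1) = _root_.digamma 1 - _root_.digamma (1 - b) := by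
  have h1 : Tendsto (fun h : ℝ ↦ ∑' n : ℕ, binCoef b (n + 1) / (n + 1 + h)) (𝓝[>] 0)
      (𝓝 (∑' n : ℕ, binCoef b (n + 1) / (n + 1))) := by
    refine tendsto_tsum_of_dominated_convergence (summable_binCoef_succ_div hb0 hb1)
      (fun n ↦ ?_) ?_
    · refine tendsto_nhdsWithin_of_tendsto_nhds ?_
      have hcont : ContinuousAt (fun h : ℝ ↦ binCoef b (n + 1) / (n + 1 + h)) 0 :=
        ContinuousAt.div (by fun_prop) (by fun_prop) (by positivity)
      simpa using hcont.tendsto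
    · filter_upwards [self_mem_nhdsWithin] with h (hh : 0 < h) n
      have := binCoef_nonneg hb0 (n + 1)
      rw [Real.norm_of_nonneg (by positivity)]
      exact div_le_div_of_nonneg_left this (by positivity) (by linarith)
  have hd := ((hasDerivAt_Gamma_div_Gamma (c := 1) (d := b) one_pos
    (by linarith)).const_mul (Real.Gamma (1 - b))).tendsto_slope_zero_right
  have hne := (Real.Gamma_pos_of_pos (s := 1 - b) (by linarith)).ne'
  have e : Real.Gamma (1 - b) * ((_root_.digamma 1 - _root_.digamma (1 - b)) *
      (Real.Gamma 1 / Real.Gamma (1 - b))) = _root_.digamma 1 - _root_.digamma (1 - b) := by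
    rw [Real.Gamma_one]
    field_simp
  rw [e] at hd
  refine tendsto_nhds_unique h1 (hd.congr' ?_)
  filter_upwards [self_mem_nhdsWithin] with h (hh : 0 < h)
  have hne2 := (Real.Gamma_pos_of_pos (s := h + 1 - b) (by linarith)).ne'
  rw [(hasSum_binCoef_succ_div_add hb0 hb1 hh).tsum_eq, add_comm 1 h, Real.Gamma_add_one hh.ne',
    Real.Gamma_one, smul_eq_mul]
  field_simp

lemma hasSum_binCoef_div_sq {b : ℝ} (hb0 : 0 < b) (hb1 : b < 1) :
    HasSum (fun n : ℕ ↦ binCoef b n / (n + b) ^ 2)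
      (Real.Gamma (1 - b) * Real.Gamma b * (_root_.digamma 1 - _root_.digamma b)) := by
  have hs : Summable (fun n : ℕ ↦ binCoef b n / (n + b) ^ 2) := by
    refine Summable.of_nonneg_of_le (fun n ↦ ?_) (fun n ↦ ?_)
      ((summable_binCoef_div hb0 hb1 hb0).mul_left (1 / b))
    · have := binCoef_nonneg hb0 n
      positivity
    · have := binCoef_nonneg hb0 n
      rw [div_mul_div_comm, one_mul, sq]
      gcongr
      have : (0 : ℝ) ≤ n := by positivity
      linarith
  have h1 : Tendsto (fun h : ℝ ↦ ∑' n : ℕ, binCoef b n / ((n + b) * (n + (b + h)))) (𝓝[>] 0)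
      (𝓝 (∑' n : ℕ, binCoef b n / (n + b) ^ 2)) := by
    refine tendsto_tsum_of_dominated_convergence hs (fun n ↦ ?_) ?_
    · refine tendsto_nhdsWithin_of_tendsto_nhds ?_
      have hcont : ContinuousAt (fun h : ℝ ↦ binCoef b n / ((n + b) * (n + (b + h)))) 0 :=
        ContinuousAt.div (by fun_prop) (by fun_prop) (by positivity)
      simpa [sq] using hcont.tendsto
    · filter_upwards [self_mem_nhdsWithin] with h (hh : 0 < h) n
      have := binCoef_nonneg hb0 n
      rw [Real.norm_of_nonneg (by positivity), sq]
      gcongr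
      linarith
  have hd := ((hasDerivAt_Gamma_div_Gamma (c := b) (d := b - 1) hb0
    (by linarith)).const_mul (-Real.Gamma (1 - b))).tendsto_slope_zero_right
  have e : -Real.Gamma (1 - b) * ((_root_.digamma b - _root_.digamma (b - (b - 1))) *
      (Real.Gamma b / Real.Gamma (b - (b - 1)))) =
      Real.Gamma (1 - b) * Real.Gamma b * (_root_.digamma 1 - _root_.digamma b) := by
    rw [sub_sub_cancel, Real.Gamma_one]
    ring
  rw [e] at hd
  have hu := tendsto_nhds_unique h1 (hd.congr' ?_)
  · rw [← hu]
    exact hs.hasSum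
  filter_upwards [self_mem_nhdsWithin] with h (hh : 0 < h)
  have hsub := ((hasSum_binCoef_div hb0 hb1 hb0).sub
    (hasSum_binCoef_div hb0 hb1 (add_pos hb0 hh))).mul_left h⁻¹
  have hterm : ∀ n : ℕ, h⁻¹ * (binCoef b n / (n + b) - binCoef b n / (n + (b + h))) =
      binCoef b n / ((n + b) * (n + (b + h))) := by
    intro n
    field_simp
    ring
  simp only [hterm] at hsub
  rw [hsub.tsum_eq, smul_eq_mul, show b + h - (b - 1) = b + h + 1 - b by ring,
    show b - (b - 1) = b + 1 - b by ring]
  ring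

lemma Gamma_add_nat_eq_mul_prod {s : ℝ} (hs : 0 < s) (n : ℕ) :
    Real.Gamma (s + n) = Real.Gamma s * ∏ k ∈ Finset.range n, (s + k) := by
  induction n with
  | zero => simp
  | succ n ih =>
    rw [Finset.prod_range_succ, ← mul_assoc, ← ih, Nat.cast_succ, ← add_assoc,
      Real.Gamma_add_one (by positivity), mul_comm]

lemma tsum_binCoef_mul_binCoef_div {a b : ℝ} (ha0 : 0 < a) (ha1 : a < 1) (hb0 : 0 < b)
    (hb1 : b < 1) :
    ∑' m : ℕ, binCoef a (m + 1) * binCoef b (m + 1) / (m + 1) =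
      2 * _root_.digamma 1 - _root_.digamma (1 - a) - _root_.digamma b -
        Real.Gamma (1 - a) / (Real.Gamma (1 - b) * Real.Gamma (1 + b - a)) *
          ∑' n : ℕ, binCoef b n * (∏ k ∈ Finset.range n, (b + k)) /
            ((∏ k ∈ Finset.range n, (1 + b - a + k)) * (n + b)) := by
  have hA := summable_binCoef_succ_div ha0 ha1
  have hB := summable_binCoef_div hb0 hb1 hb0
  have hA0 : ∀ m : ℕ, 0 ≤ binCoef a (m + 1) := fun m ↦ binCoef_nonneg ha0 _
  have hB0 : ∀ n : ℕ, 0 ≤ binCoef b n := fun n ↦ binCoef_nonneg hb0 _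
  have hf : Summable (fun p : ℕ × ℕ ↦ binCoef a (p.1 + 1) / (p.1 + 1) *
      (binCoef b p.2 / (p.2 + b))) :=
    hA.mul_of_nonneg hB (fun m ↦ div_nonneg (hA0 m) (by positivity))
      (fun n ↦ div_nonneg (hB0 n) (by positivity))
  have hsplit : ∀ p : ℕ × ℕ, binCoef a (p.1 + 1) / (p.1 + 1) * (binCoef b p.2 / (p.2 + b)) =
      binCoef a (p.1 + 1) / (p.1 + 1) * (binCoef b p.2 / (p.2 + (b + (p.1 + 1 : ℕ)))) +
      binCoef b p.2 / (p.2 + b) * (binCoef a (p.1 + 1) / (p.1 + 1 + (b + p.2))) := by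
    intro p
    push_cast
    field_simp
    ring
  have hpos1 : ∀ p : ℕ × ℕ, 0 ≤
      binCoef a (p.1 + 1) / (p.1 + 1) * (binCoef b p.2 / (p.2 + (b + (p.1 + 1 : ℕ)))) := by
    intro p
    have := hA0 p.1
    have := hB0 p.2
    positivity
  have hpos2 : ∀ p : ℕ × ℕ, 0 ≤
      binCoef b p.2 / (p.2 + b) * (binCoef a (p.1 + 1) / (p.1 + 1 + (b + p.2))) := by
    intro p
    have := hA0 p.1
    have := hB0 p.2
    positivity
  have hg1 := hf.of_nonneg_of_le hpos1 (fun p ↦ by rw [hsplit p]; linarith [hpos2 p])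
  have hg2 := hf.of_nonneg_of_le hpos2 (fun p ↦ by rw [hsplit p]; linarith [hpos1 p])
  have hsum := hA.tsum_mul_tsum hB hf
  rw [tsum_binCoef_succ_div ha0 ha1, (hasSum_binCoef_div hb0 hb1 hb0).tsum_eq, tsum_congr hsplit,
    hg1.tsum_add hg2] at hsum
  have hn1 := (Real.Gamma_pos_of_pos (s := 1 - b) (by linarith)).ne'
  have hn2 := (Real.Gamma_pos_of_pos hb0).ne'
  have hn3 := (Real.Gamma_pos_of_pos (s := 1 + b - a) (by linarith)).ne'
  have e1 : ∑' p : ℕ × ℕ, binCoef a (p.1 + 1) / (p.1 + 1) *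
      (binCoef b p.2 / (p.2 + (b + (p.1 + 1 : ℕ)))) = Real.Gamma (1 - b) * Real.Gamma b *
        ∑' m : ℕ, binCoef a (m + 1) * binCoef b (m + 1) / (m + 1) := by
    rw [hg1.tsum_prod, ← tsum_mul_left]
    refine tsum_congr fun m ↦ ?_
    simp only
    rw [tsum_mul_left, (hasSum_binCoef_div hb0 hb1 (c := b + (m + 1 : ℕ)) (by positivity)).tsum_eq,
      Gamma_add_nat_eq_mul_prod hb0, show b + ((m + 1 : ℕ) : ℝ) + 1 - b = (m + 1 : ℕ) + 1 by ring,
      Real.Gamma_nat_eq_factorial, binCoef.eq_def b]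
    ring
  have hg2' : Summable (fun p : ℕ × ℕ ↦
      binCoef b p.1 / (p.1 + b) * (binCoef a (p.2 + 1) / (p.2 + 1 + (b + p.1)))) :=
    hg2.prod_symm
  have hinner : ∀ n : ℕ, ∑' m : ℕ, binCoef b n / (n + b) *
      (binCoef a (m + 1) / (m + 1 + (b + n))) =
      Real.Gamma (1 - a) * Real.Gamma b / Real.Gamma (1 + b - a) *
        (binCoef b n * (∏ k ∈ Finset.range n, (b + k)) /
            ((∏ k ∈ Finset.range n, (1 + b - a + k)) * (n + b))) -
        binCoef b n / (n + b) ^ 2 := by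
    intro n
    rw [tsum_mul_left,
      (hasSum_binCoef_succ_div_add ha0 ha1 (c := b + n) (by positivity)).tsum_eq,
      show b + (n : ℝ) + 1 - a = (1 + b - a) + n by ring, Gamma_add_nat_eq_mul_prod hb0,
      Gamma_add_nat_eq_mul_prod (s := 1 + b - a) (by linarith)]
    have : (n : ℝ) + b ≠ 0 := by positivity
    have : ∏ k ∈ Finset.range n, (1 + b - a + (k : ℝ)) ≠ 0 :=
      (Finset.prod_pos fun k _ ↦ by have : (0 : ℝ) ≤ k := k.cast_nonneg; linarith).ne'
    rw [add_comm b (n : ℝ)]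
    field_simp
  have hsq := hasSum_binCoef_div_sq hb0 hb1
  have e2 : ∑' p : ℕ × ℕ, binCoef b p.2 / (p.2 + b) * (binCoef a (p.1 + 1) / (p.1 + 1 + (b + p.2)))
      = Real.Gamma (1 - a) * Real.Gamma b / Real.Gamma (1 + b - a) *
        ∑' n : ℕ, binCoef b n * (∏ k ∈ Finset.range n, (b + k)) /
            ((∏ k ∈ Finset.range n, (1 + b - a + k)) * (n + b)) -
        Real.Gamma (1 - b) * Real.Gamma b * (_root_.digamma 1 - _root_.digamma b) := by
    have hs := (hg2'.prod).hasSum.add hsq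
    have e3 := hg2'.tsum_prod
    simp only [hinner] at hs e3
    rw [← (Equiv.prodComm ℕ ℕ).tsum_eq]
    simp only [Equiv.prodComm_apply, Prod.fst_swap, Prod.snd_swap]
    simp only [sub_add_cancel] at hs
    rw [← tsum_mul_left, hs.tsum_eq, e3]
    ring
  rw [e1, e2, show b + 1 - b = 1 by ring, Real.Gamma_one, div_one] at hsum
  have hX : Real.Gamma (1 - b) * Real.Gamma b ≠ 0 := mul_ne_zero hn1 hn2
  refine mul_left_cancel₀ hX ?_
  have e4 : ∀ T : ℝ, Real.Gamma (1 - b) * Real.Gamma b *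
      (Real.Gamma (1 - a) / (Real.Gamma (1 - b) * Real.Gamma (1 + b - a)) * T) =
      Real.Gamma (1 - a) * Real.Gamma b / Real.Gamma (1 + b - a) * T := by
    intro T
    field_simp
  rw [mul_sub _ _ (_ / _ * _), e4]
  linarith

lemma sin_mul_digamma_one_sub {a : ℝ} (ha0 : 0 < a) (ha1 : a < 1) :
    Real.sin (π * a) * (_root_.digamma (1 - a) - _root_.digamma a) = π * Real.cos (π * a) := by
  have hsin : 0 < Real.sin (π * a) :=
    Real.sin_pos_of_pos_of_lt_pi (by positivity) (by nlinarith [Real.pi_pos])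
  have h1 : HasDerivAt (fun s : ℝ ↦ Real.Gamma s * Real.Gamma (1 - s)) _ a :=
    (hasDerivAt_realGamma ha0).mul
      (HasDerivAt.comp_const_sub 1 a (hasDerivAt_realGamma (s := 1 - a) (by linarith)))
  have h2 : HasDerivAt (fun s : ℝ ↦ π / Real.sin (π * s)) _ a :=
    (hasDerivAt_const a π).div (((hasDerivAt_id a).const_mul π).sin) hsin.ne'
  simp only [Real.Gamma_mul_Gamma_one_sub] at h1
  have h := h1.unique h2
  have hr := Real.Gamma_mul_Gamma_one_sub a
  have e : (_root_.digamma a - _root_.digamma (1 - a)) * (Real.Gamma a * Real.Gamma (1 - a)) =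
      -(π * (Real.cos (π * a) * π)) / Real.sin (π * a) ^ 2 := by
    simp only [id] at h
    linear_combination h
  rw [hr] at e
  have hpi := Real.pi_pos.ne'
  generalize Real.sin (π * a) = s at *
  generalize Real.cos (π * a) = c at *
  field_simp at e
  linear_combination -e

lemma pochC_ofReal (a : ℝ) (n : ℕ) :
    pochC a n = ((∏ k ∈ Finset.range n, (a + k) : ℝ) : ℂ) := by
  simp [pochC]

lemma pochC_one (n : ℕ) : pochC 1 n = n.factorial := by
  induction n with
  | zero => simp [pochC]
  | succ n ih =>
    rw [pochC] at ih ⊢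
    rw [Finset.prod_range_succ, ih, Nat.factorial_succ]
    push_cast
    ring

lemma mul_pochC_add_one (a : ℂ) (n : ℕ) : a * pochC (a + 1) n = pochC a (n + 1) := by
  rw [pochC, pochC, Finset.prod_range_succ', mul_comm]
  simp only [Nat.cast_add, Nat.cast_one, Nat.cast_zero, add_zero]
  congr 1
  exact Finset.prod_congr rfl fun k _ ↦ by ring

lemma pochC_two (n : ℕ) : pochC 2 n = (n + 1).factorial := by
  rw [← pochC_one, ← mul_pochC_add_one, one_mul]
  norm_num

lemma mul_hyp4F3_eq_ofReal_tsum (a b : ℝ) :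
    (a : ℂ) * b * hyp4F3 (a + 1) (b + 1) 1 1 2 2 2 1 =
      ((∑' m : ℕ, binCoef a (m + 1) * binCoef b (m + 1) / (m + 1) : ℝ) : ℂ) := by
  rw [hyp4F3, ← tsum_mul_left, Complex.ofReal_tsum]
  refine tsum_congr fun m ↦ ?_
  rw [binCoef, binCoef]
  push_cast [← pochC_ofReal]
  have h1 : (m.factorial : ℂ) ≠ 0 := by exact_mod_cast m.factorial_ne_zero
  have h2 : (m : ℂ) + 1 ≠ 0 := by exact_mod_cast m.succ_ne_zero
  have ea := pochC_ofReal a (m + 1)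
  have eb := pochC_ofReal b (m + 1)
  push_cast at ea eb
  rw [← ea, ← eb, ← mul_pochC_add_one, ← mul_pochC_add_one, pochC_one, pochC_two,
    Nat.factorial_succ]
  push_cast
  rw [one_pow]
  field_simp

lemma inv_mul_hyp3F2_eq_ofReal_tsum {a : ℝ} (ha : 0 < a) (d : ℝ) :
    (a : ℂ)⁻¹ * hyp3F2 a a a d ((a : ℂ) + 1) 1 =
      ((∑' n : ℕ, binCoef a n * (∏ k ∈ Finset.range n, (a + k)) /
        ((∏ k ∈ Finset.range n, (d + k)) * (n + a)) : ℝ) : ℂ) := by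
  rw [hyp3F2, ← tsum_mul_left, Complex.ofReal_tsum]
  refine tsum_congr fun n ↦ ?_
  have ea := pochC_ofReal a n
  have ed := pochC_ofReal d n
  have h1 : (a : ℂ) ≠ 0 := by exact_mod_cast ha.ne'
  have h2 : (n : ℂ) + a ≠ 0 := by exact_mod_cast (by positivity : (n : ℝ) + a ≠ 0)
  have h3 : pochC a n ≠ 0 := by
    rw [ea]
    exact_mod_cast (by positivity : (∏ k ∈ Finset.range n, (a + k) : ℝ) ≠ 0)
  have h4 : (a : ℂ) * pochC (a + 1) n = pochC a n * (n + a) := by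
    rw [mul_pochC_add_one, pochC, pochC, Finset.prod_range_succ, add_comm (n : ℂ)]
  have h5 : pochC ((a : ℂ) + 1) n = pochC a n * (n + a) / a := by
    rw [← h4]
    field_simp
  rw [binCoef, h5, Complex.ofReal_div, Complex.ofReal_mul, Complex.ofReal_mul, Complex.ofReal_div,
    ← ea, ← ed]
  push_cast
  simp only [one_pow, mul_one, div_eq_mul_inv, mul_inv, inv_inv]
  field_simp

lemma Cab_eq_ofReal {a b : ℝ} (hb0 : 0 < b) (hb1 : b < 1)
    (hba : Real.sin (π * (b - a)) ≠ 0) (hpos : 0 < 1 + a - b) :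
    Cab a b = ((Real.sin (π * b) / Real.sin (π * (b - a)) *
      (Real.Gamma (1 - b) / (Real.Gamma (1 - a) * Real.Gamma (1 + a - b))) : ℝ) : ℂ) := by
  have h : Cab a b = ((Real.Gamma (b - a) / (Real.Gamma (1 - a) * Real.Gamma b) : ℝ) : ℂ) := by
    rw [Cab]
    push_cast [← Complex.Gamma_ofReal]
    rfl
  rw [h, Complex.ofReal_inj]
  have hr1 := Real.Gamma_mul_Gamma_one_sub (b - a)
  have hr2 := Real.Gamma_mul_Gamma_one_sub b
  rw [show 1 - (b - a) = 1 + a - b by ring] at hr1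
  have hsin : Real.sin (π * b) ≠ 0 :=
    (Real.sin_pos_of_pos_of_lt_pi (by positivity) (by nlinarith [Real.pi_pos])).ne'
  have g1 := (Real.Gamma_pos_of_pos hpos).ne'
  have g2 := (Real.Gamma_pos_of_pos hb0).ne'
  have g3 := (Real.Gamma_pos_of_pos (s := 1 - b) (by linarith)).ne'
  rw [eq_div_iff hba] at hr1
  rw [eq_div_iff hsin] at hr2
  have key : Real.Gamma (b - a) / Real.Gamma b = Real.sin (π * b) / Real.sin (π * (b - a)) *
      (Real.Gamma (1 - b) / Real.Gamma (1 + a - b)) := by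
    generalize Real.sin (π * b) = s at *
    generalize Real.sin (π * (b - a)) = t at *
    field_simp
    linear_combination hr1 - hr2
  rw [mul_comm (Real.Gamma (1 - a)), ← div_div, key, mul_comm (Real.Gamma (1 - a)), ← div_div]
  ring

lemma mul_tsum_eq_digamma {a b : ℝ} (ha0 : 0 < a) (ha1 : a < 1) (hb0 : 0 < b) (hb1 : b < 1) :
    Real.sin (π * b) * (Real.Gamma (1 - b) / (Real.Gamma (1 - a) * Real.Gamma (1 + a - b)) *
        ∑' n : ℕ, binCoef a n * (∏ k ∈ Finset.range n, (a + k)) /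
            ((∏ k ∈ Finset.range n, (1 + a - b + k)) * (n + a))) =
      Real.sin (π * b) * (2 * _root_.digamma 1 - _root_.digamma a - _root_.digamma b -
        ∑' m : ℕ, binCoef a (m + 1) * binCoef b (m + 1) / (m + 1)) - π * Real.cos (π * b) := by
  have h := tsum_binCoef_mul_binCoef_div hb0 hb1 ha0 ha1
  simp only [mul_comm (binCoef b (_ + 1))] at h
  linear_combination Real.sin (π * b) * h - sin_mul_digamma_one_sub hb0 hb1

end

theorem stmt0 (a b : ℝ) (ha0 : 0 < a) (ha1 : a < 1) (hb0 : 0 < b) (hb1 : b < 1)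
    (hab : a ≠ b) :
    (π : ℂ) * I + 2 * (digamma 1 : ℝ) - (digamma a : ℝ) - (digamma b : ℝ)
        - (a : ℂ) * (b : ℂ) * hyp4F3 (a + 1) (b + 1) 1 1 2 2 2 1
      = (a : ℂ)⁻¹ * Cab a b * Complex.exp ((π : ℂ) * I * a) *
          hyp3F2 a a a (1 + (a : ℂ) - b) ((a : ℂ) + 1) 1
        + (b : ℂ)⁻¹ * Cab b a * Complex.exp ((π : ℂ) * I * b) *
          hyp3F2 b b b (1 - (a : ℂ) + b) ((b : ℂ) + 1) 1 := by
  have hsin : Real.sin (π * (b - a)) ≠ 0 := by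
    intro h
    have hpi := Real.pi_pos
    rcases lt_or_gt_of_ne hab with hlt | hlt
    · exact (Real.sin_pos_of_pos_of_lt_pi (mul_pos hpi (by linarith)) (by nlinarith)).ne' h
    · exact (Real.sin_neg_of_neg_of_neg_pi_lt (by nlinarith) (by nlinarith)).ne h
  have hsin' : Real.sin (π * (a - b)) = -Real.sin (π * (b - a)) := by
    rw [← Real.sin_neg]
    ring_nf
  have hA := inv_mul_hyp3F2_eq_ofReal_tsum ha0 (1 + a - b)
  have hB := inv_mul_hyp3F2_eq_ofReal_tsum hb0 (1 + b - a)
  have kA := mul_tsum_eq_digamma ha0 ha1 hb0 hb1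
  have kB := mul_tsum_eq_digamma hb0 hb1 ha0 ha1
  have hCA := Cab_eq_ofReal hb0 hb1 hsin (by linarith)
  have hCB := Cab_eq_ofReal (a := b) ha0 ha1 (by rw [hsin']; exact neg_ne_zero.2 hsin)
    (by linarith)
  simp only [mul_comm (binCoef b (_ + 1))] at kB
  have hadd : Real.sin (π * (b - a)) = Real.sin (π * b) * Real.cos (π * a) -
      Real.cos (π * b) * Real.sin (π * a) := by
    rw [mul_sub, Real.sin_sub]
  have ea : cexp (π * I * a) = Real.cos (π * a) + Real.sin (π * a) * I := by
    rw [show (π : ℂ) * I * a = ((π * a : ℝ) : ℂ) * I by push_cast; ring, Complex.exp_mul_I]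
    push_cast
    rfl
  have eb : cexp (π * I * b) = Real.cos (π * b) + Real.sin (π * b) * I := by
    rw [show (π : ℂ) * I * b = ((π * b : ℝ) : ℂ) * I by push_cast; ring, Complex.exp_mul_I]
    push_cast
    rfl
  rw [mul_hyp4F3_eq_ofReal_tsum]
  generalize (∑' n : ℕ, binCoef a n * (∏ k ∈ Finset.range n, (a + k)) /
    ((∏ k ∈ Finset.range n, (1 + a - b + k)) * (n + a))) = TA at hA kA
  generalize (∑' n : ℕ, binCoef b n * (∏ k ∈ Finset.range n, (b + k)) /
    ((∏ k ∈ Finset.range n, (1 + b - a + k)) * (n + b))) = TB at hB kB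
  generalize (∑' m : ℕ, binCoef a (m + 1) * binCoef b (m + 1) / (m + 1)) = S at kA kB ⊢
  push_cast at hA hB
  rw [show (1 : ℂ) + b - a = 1 - a + b by ring] at hB
  rw [mul_right_comm _ (cexp _), mul_right_comm _ (cexp _), mul_right_comm _ (Cab a b),
    mul_right_comm _ (Cab b a), hA, hB, hCA, hCB, ea, eb, hsin', ← Complex.ofReal_mul,
    ← Complex.ofReal_mul]
  generalize Real.Gamma (1 - b) / (Real.Gamma (1 - a) * Real.Gamma (1 + a - b)) = GA at kA ⊢
  generalize Real.Gamma (1 - a) / (Real.Gamma (1 - b) * Real.Gamma (1 + b - a)) = GB at kB ⊢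
  generalize Real.sin (π * (b - a)) = s at *
  generalize Real.sin (π * a) = sa at *
  generalize Real.cos (π * a) = ca at *
  generalize Real.sin (π * b) = sb at *
  generalize Real.cos (π * b) = cb at *
  have uA : TA * (sb / s * GA) = (sb * (2 * _root_.digamma 1 - _root_.digamma a -
      _root_.digamma b - S) - π * cb) / s := by
    rw [← kA]
    ring
  have uB : TB * (sa / -s * GB) = -(sa * (2 * _root_.digamma 1 - _root_.digamma b -
      _root_.digamma a - S) - π * ca) / s := by
    rw [← kB, div_neg]
    ring
  have hs : (s : ℂ) ≠ 0 := by exact_mod_cast hsin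
  have hc : (s : ℂ) = sb * ca - cb * sa := by exact_mod_cast hadd
  rw [uA, uB]
  push_cast
  field_simp
  linear_combination (π * I + 2 * _root_.digamma 1 - _root_.digamma a - _root_.digamma b - S) * hc
end

section
/- Let n, m ≥ 2 be integers, let ν₁ be an n-th root of unity with ν₁ ≠ 1, let ν₂ be an m-th root of unity with ν₂ ≠ 1, let ε₁ be an n-th root of unity and ε₂ an m-th root of unity. Then the complex number S + C₀ is a rational multiple of 2πi, where S := Σ_{i=1}^{n−1} Σ_{j=1}^{m−1} (1−ν₁^{−i})(1−ν₂^{−j}) · (ε₁^i ε₂^j)/(nm) · ( 2ψ(1) − ψ(1−i/n) − ψ(1−j/m) ), and C₀ is given by: C₀ = −log(nm(1−ν₁)(1−ν₂)) if (ε₁,ε₂) = (1,1) or (ν₁,ν₂); C₀ = log(nm(1−ν₁)(1−ν₂)) if (ε₁,ε₂) = (1,ν₂) or (ν₁,1); C₀ = log((ε₂−1)/(ε₂−ν₂)) if ε₁ = 1 and ε₂ ∉ {1, ν₂}; C₀ = log((ε₁−1)/(ε₁−ν₁)) if ε₂ = 1 and ε₁ ∉ {1, ν₁}; C₀ = −log((ε₂−1)/(ε₂−ν₂))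 if ε₁ = ν₁ and ε₂ ∉ {1, ν₂}; C₀ = −log((ε₁−1)/(ε₁−ν₁)) if ε₂ = ν₂ and ε₁ ∉ {1, ν₁}; and C₀ = 0 in all other cases. Here log denotes any fixed branch of the complex logarithm (the claim modulo 2πi·ℚ is independent of the branch). -/
set_option autoImplicit false

open scoped Real Classical

open Filter Topology

lemma digamma_eq_deriv_log_Gamma {x : ℝ} (hx : 0 < x) :
    digamma x = deriv (Real.log ∘ Real.Gamma) x := by
  rw [digamma, Function.comp_def, deriv.log (Real.differentiableAt_Gamma fun m ↦ ?_)
    (Real.Gamma_pos_of_pos hx).ne']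
  exact ne_of_gt (lt_of_le_of_lt (by simp) hx)

lemma differentiableAt_log_Gamma {x : ℝ} (hx : 0 < x) :
    DifferentiableAt ℝ (Real.log ∘ Real.Gamma) x :=
  (Real.differentiableAt_Gamma fun m ↦ ne_of_gt (lt_of_le_of_lt (by simp) hx)).log
    (Real.Gamma_pos_of_pos hx).ne'

lemma monotoneOn_digamma : MonotoneOn digamma (Set.Ioi 0) := by
  have h := Real.convexOn_log_Gamma.monotoneOn_deriv
    (fun x hx ↦ differentiableAt_log_Gamma hx)
  exact h.congr fun x hx ↦ (digamma_eq_deriv_log_Gamma hx).symm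

lemma digamma_add_one {x : ℝ} (hx : 0 < x) : digamma (x + 1) = digamma x + 1 / x := by
  rw [digamma_eq_deriv_log_Gamma hx, digamma_eq_deriv_log_Gamma (by positivity),
    ← deriv_comp_add_const, one_div, ← Real.deriv_log,
    ← deriv_add (differentiableAt_log_Gamma hx) (Real.differentiableAt_log hx.ne')]
  apply EventuallyEq.deriv_eq
  filter_upwards [eventually_gt_nhds hx] with y hy
  simp only [Function.comp_apply, Pi.add_apply]
  rw [Real.Gamma_add_one hy.ne', Real.log_mul hy.ne' (Real.Gamma_pos_of_pos hy).ne', add_comm]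

lemma digamma_add_nat {x : ℝ} (hx : 0 < x) (N : ℕ) :
    digamma (x + N) = digamma x + ∑ k ∈ Finset.range N, 1 / (x + k) := by
  induction N with
  | zero => simp
  | succ N ih =>
    rw [Finset.sum_range_succ, ← add_assoc, ← ih, ← digamma_add_one (by positivity)]
    push_cast
    ring_nf

lemma tendsto_digamma_sub {x : ℝ} (hx : 0 < x) (hx1 : x ≤ 1) :
    Tendsto (fun N : ℕ ↦ digamma (x + N) - digamma (1 + N)) atTop (𝓝 0) := by
  have h0 : Tendsto (fun N : ℕ ↦ -(1 / (N : ℝ))) atTop (𝓝 0) := by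
    simpa using tendsto_one_div_atTop_nhds_zero_nat (𝕜 := ℝ).neg
  refine tendsto_of_tendsto_of_tendsto_of_le_of_le' h0 tendsto_const_nhds ?_ ?_
  · filter_upwards [eventually_gt_atTop 0] with N hN
    have hN' : (0 : ℝ) < N := by exact_mod_cast hN
    have h1 := monotoneOn_digamma (Set.mem_Ioi.2 hN')
      (Set.mem_Ioi.2 (by positivity : 0 < x + N)) (by linarith)
    have h2 := digamma_add_one hN'
    rw [add_comm (N : ℝ) 1] at h2
    linarith
  · filter_upwards with N
    have h1 := monotoneOn_digamma (Set.mem_Ioi.2 (by positivity : 0 < x + N))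
      (Set.mem_Ioi.2 (by positivity : (0 : ℝ) < 1 + N)) (by linarith)
    linarith

lemma tendsto_sum_digamma {x : ℝ} (hx : 0 < x) (hx1 : x ≤ 1) :
    Tendsto (fun N : ℕ ↦ (∑ k ∈ Finset.range N, 1 / (x + k)) - ∑ k ∈ Finset.range N, 1 / (1 + (k : ℝ)))
      atTop (𝓝 (digamma 1 - digamma x)) := by
  have h := (tendsto_digamma_sub hx hx1).add_const (digamma 1 - digamma x)
  rw [zero_add] at h
  refine h.congr fun N ↦ ?_
  rw [digamma_add_nat hx, digamma_add_nat one_pos]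
  ring

/-- The logarithm series converges on the unit circle away from `1`. -/
lemma tendsto_sum_pow_div_neg_log {w : ℂ} (hw : ‖w‖ = 1) (hw1 : w ≠ 1) :
    Tendsto (fun N ↦ ∑ l ∈ Finset.range N, w ^ (l + 1) / ((l : ℂ) + 1)) atTop
      (𝓝 (-Complex.log (1 - w))) := by
  have hanti : Antitone fun l : ℕ ↦ 1 / ((l : ℝ) + 1) := fun a b hab ↦
    Nat.one_div_le_one_div hab
  have hbound : ∀ N, ‖∑ l ∈ Finset.range N, w ^ (l + 1)‖ ≤ 2 / ‖w - 1‖ := by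
    intro N
    simp_rw [pow_succ]
    rw [← Finset.sum_mul, geom_sum_eq hw1, norm_mul, hw, mul_one, norm_div]
    gcongr
    calc ‖w ^ N - 1‖ ≤ ‖w ^ N‖ + ‖(1 : ℂ)‖ := norm_sub_le _ _
      _ = 2 := by simp [hw]; norm_num
  have hc := hanti.cauchySeq_series_mul_of_tendsto_zero_of_bounded
    tendsto_one_div_add_atTop_nhds_zero_nat hbound
  have hfun : (fun N ↦ ∑ l ∈ Finset.range N, (1 / ((l : ℝ) + 1)) • w ^ (l + 1)) =
      fun N ↦ ∑ l ∈ Finset.range N, w ^ (l + 1) / ((l : ℂ) + 1) := by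
    ext N
    refine Finset.sum_congr rfl fun l _ ↦ ?_
    rw [Complex.real_smul]
    push_cast
    ring
  rw [hfun] at hc
  obtain ⟨L, hL⟩ := cauchySeq_tendsto_of_complete hc
  have habel := Complex.tendsto_tsum_powerSeries_nhdsWithin_lt hL
  rw [tendsto_map'_iff] at habel
  have hslit : 1 - w ∈ Complex.slitPlane := by
    rw [Complex.mem_slitPlane_iff]
    by_contra! h
    obtain ⟨h1, h2⟩ := h
    simp only [Complex.sub_re, Complex.one_re, Complex.sub_im, Complex.one_im, zero_sub,
      neg_eq_zero] at h1 h2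
    have h3 := Complex.re_le_norm w
    rw [hw] at h3
    exact hw1 (Complex.ext (by simp; linarith) (by simp [h2]))
  have hlog : Tendsto (fun x : ℝ ↦ (x : ℂ)⁻¹ * -Complex.log (1 - w * x)) (𝓝[<] 1)
      (𝓝 (-Complex.log (1 - w))) := by
    have hcont : ContinuousAt (fun x : ℝ ↦ (x : ℂ)⁻¹ * -Complex.log (1 - w * x)) 1 := by
      have h1 : ContinuousAt (fun x : ℝ ↦ (x : ℂ)) 1 := Complex.continuous_ofReal.continuousAt
      refine (h1.inv₀ (by simp)).mul (ContinuousAt.clog ?_ (by simpa using hslit)).neg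
      fun_prop
    simpa using hcont.tendsto.mono_left nhdsWithin_le_nhds
  have heq : (fun x : ℝ ↦ (x : ℂ)⁻¹ * -Complex.log (1 - w * x)) =ᶠ[𝓝[<] 1]
      ((fun z : ℂ ↦ ∑' l : ℕ, w ^ (l + 1) / ((l : ℂ) + 1) * z ^ l) ∘ Complex.ofReal) := by
    filter_upwards [Ioo_mem_nhdsLT (zero_lt_one (α := ℝ))] with x hx
    have hx0 : (x : ℂ) ≠ 0 := by exact_mod_cast hx.1.ne'
    have hn : ‖w * x‖ < 1 := by
      rw [norm_mul, hw, one_mul, Complex.norm_real, Real.norm_of_nonneg hx.1.le]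
      exact hx.2
    have hs := (Complex.hasSum_taylorSeries_neg_log hn)
    rw [← hasSum_nat_add_iff' 1] at hs
    simp only [Finset.range_one, Finset.sum_singleton, Nat.cast_zero, div_zero, sub_zero] at hs
    rw [← hs.tsum_eq, ← tsum_mul_left, Function.comp_apply]
    refine tsum_congr fun l ↦ ?_
    push_cast
    field_simp
    ring
  have hLeq := tendsto_nhds_unique (hlog.congr' heq) habel
  rw [hLeq]
  exact hL

lemma sum_pow_mul_eq {n : ℕ} (hn : 0 < n) {ζ : ℂ} (hζ : ζ ^ n = 1) (N : ℕ) :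
    ∑ i ∈ Finset.range n, ζ ^ i * ∑ k ∈ Finset.range N, 1 / (1 - (i : ℂ) / n + k) =
      n * ∑ l ∈ Finset.range (N * n), ζ⁻¹ ^ (l + 1) / ((l : ℂ) + 1) := by
  have hζ0 : ζ ≠ 0 := by
    rintro rfl
    simp [hn.ne'] at hζ
  have hn0 : (n : ℂ) ≠ 0 := by exact_mod_cast hn.ne'
  induction N with
  | zero => simp
  | succ N ih =>
    rw [add_mul, one_mul, Finset.sum_range_add, mul_add, ← ih]
    simp_rw [Finset.sum_range_succ _ N, mul_add]
    rw [Finset.sum_add_distrib]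
    congr 1
    rw [Finset.mul_sum, ← Finset.sum_range_reflect]
    refine Finset.sum_congr rfl fun j hj ↦ ?_
    have hj' : j + 1 ≤ n := Finset.mem_range.1 hj
    have hpow : ζ ^ (n - 1 - j) = ζ⁻¹ ^ (N * n + j + 1) := by
      rw [inv_pow]
      refine eq_inv_of_mul_eq_one_left ?_
      rw [← pow_add,
        show n - 1 - j + (N * n + j + 1) = n * (N + 1) by rw [mul_add, mul_comm]; omega,
        pow_mul, hζ, one_pow]
    have hcast : ((n - 1 - j : ℕ) : ℂ) = n - 1 - j := by
      rw [Nat.sub_sub, Nat.cast_sub (by omega)]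
      push_cast
      ring
    have hne : (N : ℂ) * n + j + 1 ≠ 0 := by exact_mod_cast Nat.succ_ne_zero (N * n + j)
    rw [hpow, hcast, show 1 - ((n : ℂ) - 1 - j) / n + N = (N * n + j + 1) / n by field_simp; ring]
    push_cast
    field_simp

lemma tendsto_sum_pow_digamma {n : ℕ} (hn : 0 < n) {ζ : ℂ} (hζ : ζ ^ n = 1) :
    Tendsto (fun N : ℕ ↦ n * ∑ l ∈ Finset.range (N * n), ζ⁻¹ ^ (l + 1) / ((l : ℂ) + 1) -
        (∑ i ∈ Finset.range n, ζ ^ i) * ∑ k ∈ Finset.range N, 1 / (1 + (k : ℂ)))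
      atTop (𝓝 (∑ i ∈ Finset.range n,
        ζ ^ i * ((digamma 1 - digamma (1 - (i : ℝ) / n) : ℝ) : ℂ))) := by
  have h : Tendsto (fun N : ℕ ↦ ∑ i ∈ Finset.range n, ζ ^ i *
      (((∑ k ∈ Finset.range N, 1 / (1 - (i : ℝ) / n + k)) -
        ∑ k ∈ Finset.range N, 1 / (1 + (k : ℝ)) : ℝ) : ℂ))
      atTop (𝓝 (∑ i ∈ Finset.range n,
        ζ ^ i * ((digamma 1 - digamma (1 - (i : ℝ) / n) : ℝ) : ℂ))) := by
    refine tendsto_finsetSum _ fun i hi ↦ Tendsto.const_mul _ ?_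
    have hn' : (0 : ℝ) < n := by exact_mod_cast hn
    have hi' : (i : ℝ) / n < 1 := by
      rw [div_lt_one hn']
      exact_mod_cast Finset.mem_range.1 hi
    exact (Complex.continuous_ofReal.tendsto _).comp
      (tendsto_sum_digamma (by linarith) (by linarith [show 0 ≤ (i : ℝ) / n by positivity]))
  refine h.congr fun N ↦ ?_
  rw [← sum_pow_mul_eq hn hζ, Finset.sum_mul, ← Finset.sum_sub_distrib]
  refine Finset.sum_congr rfl fun i _ ↦ ?_
  push_cast
  ring

lemma sum_digamma_pow_of_ne_one {n : ℕ} (hn : 0 < n) {ζ : ℂ} (hζ : ζ ^ n = 1) (hζ1 : ζ ≠ 1) :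
    ∑ i ∈ Finset.range n, ζ ^ i * ((digamma 1 - digamma (1 - (i : ℝ) / n) : ℝ) : ℂ) =
      n * -Complex.log (1 - ζ⁻¹) := by
  refine tendsto_nhds_unique (tendsto_sum_pow_digamma hn hζ) ?_
  have hnorm : ‖ζ⁻¹‖ = 1 := by
    rw [norm_inv, Complex.norm_eq_one_of_pow_eq_one hζ hn.ne', inv_one]
  have h := (tendsto_sum_pow_div_neg_log hnorm (by simpa using hζ1)).comp
    (tendsto_id.atTop_mul_const' hn)
  simp only [geom_sum_eq hζ1, hζ, sub_self, zero_div, zero_mul, sub_zero]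
  exact h.const_mul _

lemma sum_digamma {n : ℕ} (hn : 0 < n) :
    ∑ i ∈ Finset.range n, (1 : ℂ) ^ i * ((digamma 1 - digamma (1 - (i : ℝ) / n) : ℝ) : ℂ) =
      n * (Real.log n : ℂ) := by
  refine tendsto_nhds_unique (tendsto_sum_pow_digamma hn (one_pow n)) ?_
  have hn' : (n : ℝ) ≠ 0 := by exact_mod_cast hn.ne'
  have h := ((Real.tendsto_harmonic_sub_log.comp (tendsto_id.atTop_mul_const' hn)).sub
    Real.tendsto_harmonic_sub_log).add_const (Real.log n)
  rw [sub_self, zero_add] at h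
  have h2 := ((Complex.continuous_ofReal.tendsto _).comp h).const_mul (n : ℂ)
  refine h2.congr' ?_
  filter_upwards [eventually_gt_atTop 0] with N hN
  have hN' : (N : ℝ) ≠ 0 := by exact_mod_cast hN.ne'
  have hH : ∀ M : ℕ, ((harmonic M : ℝ) : ℂ) = ∑ k ∈ Finset.range M, 1 / (1 + (k : ℂ)) := by
    intro M
    rw [harmonic]
    push_cast
    exact Finset.sum_congr rfl fun k _ ↦ by rw [one_div, add_comm]
  simp only [Function.comp_apply, id]
  have hreal : (harmonic (N * n) : ℝ) - Real.log ((N * n : ℕ) : ℝ) - (harmonic N - Real.log N)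
      + Real.log n = harmonic (N * n) - harmonic N := by
    rw [Nat.cast_mul, Real.log_mul hN' hn']
    ring
  rw [hreal, Complex.ofReal_sub, hH, hH]
  simp [mul_sub, add_comm]

/-- The single-variable digamma sum attached to the roots of unity `ν` and `ε`. -/
noncomputable def digammaSum (n : ℕ) (ν ε : ℂ) : ℂ :=
  (∑ i ∈ Finset.Ico 1 n, (1 - ν⁻¹ ^ i) * ε ^ i *
    ((digamma 1 - digamma (1 - (i : ℝ) / n) : ℝ) : ℂ)) / n

lemma sum_Ico_one_sub_inv_pow {n : ℕ} (hn : 0 < n) (ν ε : ℂ) (f : ℕ → ℂ) :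
    ∑ i ∈ Finset.Ico 1 n, (1 - ν⁻¹ ^ i) * ε ^ i * f i =
      ∑ i ∈ Finset.range n, ε ^ i * f i - ∑ i ∈ Finset.range n, (ε * ν⁻¹) ^ i * f i := by
  rw [← Finset.sum_sub_distrib, Finset.range_eq_Ico, Finset.sum_eq_sum_Ico_succ_bot hn]
  simp only [pow_zero, sub_self, zero_add]
  exact Finset.sum_congr rfl fun i _ ↦ by rw [mul_pow]; ring

section RootsOfUnity

variable {n : ℕ} {ν ε : ℂ}

lemma mul_inv_pow_eq_one (hν : ν ^ n = 1) (hε : ε ^ n = 1) : (ε * ν⁻¹) ^ n = 1 := by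
  rw [mul_pow, inv_pow, hν, hε, inv_one, one_mul]

lemma geom_sum_rootsOfUnity (hε : ε ^ n = 1) :
    ∑ i ∈ Finset.range n, ε ^ i = n * if ε = 1 then 1 else 0 := by
  split_ifs with h
  · simp [h]
  · rw [geom_sum_eq h, hε]
    simp

lemma sum_Ico_char (hn : 0 < n) (hν : ν ^ n = 1) (hε : ε ^ n = 1) :
    ∑ i ∈ Finset.Ico 1 n, (1 - ν⁻¹ ^ i) * ε ^ i =
      n * ((if ε = 1 then 1 else 0) - if ε = ν then 1 else 0) := by
  have h := sum_Ico_one_sub_inv_pow hn ν ε 1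
  have hν0 : ν ≠ 0 := by
    rintro rfl
    simp [hn.ne'] at hν
  simp only [Pi.one_apply, mul_one] at h
  rw [h, geom_sum_rootsOfUnity hε, geom_sum_rootsOfUnity (mul_inv_pow_eq_one hν hε), mul_sub]
  simp only [mul_inv_eq_one₀ hν0]

lemma digammaSum_eq (hn : 0 < n) :
    digammaSum n ν ε = ((∑ i ∈ Finset.range n,
        ε ^ i * ((digamma 1 - digamma (1 - (i : ℝ) / n) : ℝ) : ℂ)) -
      ∑ i ∈ Finset.range n,
        (ε * ν⁻¹) ^ i * ((digamma 1 - digamma (1 - (i : ℝ) / n) : ℝ) : ℂ)) / n := by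
  rw [digammaSum, sum_Ico_one_sub_inv_pow hn ν ε
    fun i ↦ ((digamma 1 - digamma (1 - (i : ℝ) / n) : ℝ) : ℂ)]

lemma exp_ofReal_log_natCast (hn : 0 < n) : Complex.exp (Real.log n) = n := by
  rw [← Complex.ofReal_exp, Real.exp_log (by exact_mod_cast hn), Complex.ofReal_natCast]

lemma exp_digammaSum_one (hn : 0 < n) (hν : ν ^ n = 1) (hν1 : ν ≠ 1) :
    Complex.exp (digammaSum n ν 1) = n * (1 - ν) := by
  have hn0 : (n : ℂ) ≠ 0 := by exact_mod_cast hn.ne'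
  have hν' : (1 * ν⁻¹) ^ n = 1 := mul_inv_pow_eq_one hν (one_pow n)
  rw [digammaSum_eq hn, sum_digamma hn, sum_digamma_pow_of_ne_one hn hν' (by simpa using hν1),
    ← mul_sub, mul_div_cancel_left₀ _ hn0, sub_neg_eq_add, Complex.exp_add,
    exp_ofReal_log_natCast hn, one_mul, inv_inv, Complex.exp_log (sub_ne_zero.2 hν1.symm)]

lemma exp_digammaSum_self (hn : 0 < n) (hν : ν ^ n = 1) (hν1 : ν ≠ 1) :
    Complex.exp (digammaSum n ν ν) = (n * (1 - ν⁻¹))⁻¹ := by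
  have hn0 : (n : ℂ) ≠ 0 := by exact_mod_cast hn.ne'
  have hν0 : ν ≠ 0 := by
    rintro rfl
    simp [hn.ne'] at hν
  have hne : 1 - ν⁻¹ ≠ 0 := sub_ne_zero.2 (by simpa using hν1)
  rw [digammaSum_eq hn, mul_inv_cancel₀ hν0, sum_digamma hn, sum_digamma_pow_of_ne_one hn hν hν1,
    ← mul_sub, mul_div_cancel_left₀ _ hn0, Complex.exp_sub, Complex.exp_neg,
    exp_ofReal_log_natCast hn, Complex.exp_log hne, mul_inv_rev, div_eq_mul_inv]

lemma exp_digammaSum_of_ne (hn : 0 < n) (hν : ν ^ n = 1) (hε : ε ^ n = 1) (hε1 : ε ≠ 1)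
    (hεν : ε ≠ ν) : Complex.exp (digammaSum n ν ε) = (ε - ν) / (ε - 1) := by
  have hn0 : (n : ℂ) ≠ 0 := by exact_mod_cast hn.ne'
  have hν0 : ν ≠ 0 := by
    rintro rfl
    simp [hn.ne'] at hν
  have hε0 : ε ≠ 0 := by
    rintro rfl
    simp [hn.ne'] at hε
  have h1 : ε * ν⁻¹ ≠ 1 := by rwa [Ne, mul_inv_eq_one₀ hν0]
  have hne : ε - 1 ≠ 0 := sub_ne_zero.2 hε1
  have hne1 : 1 - ε⁻¹ ≠ 0 := sub_ne_zero.2 (by simpa using hε1)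
  have hne2 : 1 - (ε * ν⁻¹)⁻¹ ≠ 0 := sub_ne_zero.2 fun h ↦ h1 (inv_eq_one.1 h.symm)
  rw [digammaSum_eq hn, sum_digamma_pow_of_ne_one hn hε hε1,
    sum_digamma_pow_of_ne_one hn (mul_inv_pow_eq_one hν hε) h1,
    ← mul_sub, mul_div_cancel_left₀ _ hn0, Complex.exp_sub, Complex.exp_neg, Complex.exp_neg,
    Complex.exp_log hne1, Complex.exp_log hne2]
  have e1 : 1 - ε⁻¹ = (ε - 1) / ε := by field_simp
  have e2 : 1 - (ε * ν⁻¹)⁻¹ = (ε - ν) / ε := by field_simp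
  rw [e1, e2]
  have := sub_ne_zero.2 hεν
  field_simp

end RootsOfUnity

lemma double_digamma_sum_eq {n m : ℕ} (hn : 0 < n) (hm : 0 < m) {ν₁ ν₂ ε₁ ε₂ : ℂ}
    (hν₁ : ν₁ ^ n = 1) (hν₂ : ν₂ ^ m = 1) (hε₁ : ε₁ ^ n = 1) (hε₂ : ε₂ ^ m = 1) :
    ∑ i ∈ Finset.Ico 1 n, ∑ j ∈ Finset.Ico 1 m,
      (1 - ν₁⁻¹ ^ i) * (1 - ν₂⁻¹ ^ j) * (ε₁ ^ i * ε₂ ^ j) / ((n : ℂ) * m) *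
        ((2 * digamma 1 - digamma (1 - (i : ℝ) / n) - digamma (1 - (j : ℝ) / m) : ℝ) : ℂ) =
      ((if ε₂ = 1 then 1 else 0) - if ε₂ = ν₂ then 1 else 0) * digammaSum n ν₁ ε₁ +
      ((if ε₁ = 1 then 1 else 0) - if ε₁ = ν₁ then 1 else 0) * digammaSum m ν₂ ε₂ := by
  have hn0 : (n : ℂ) ≠ 0 := by exact_mod_cast hn.ne'
  have hm0 : (m : ℂ) ≠ 0 := by exact_mod_cast hm.ne'
  rw [eq_div_of_mul_eq hn0 ((mul_comm _ _).trans (sum_Ico_char hn hν₁ hε₁).symm),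
    eq_div_of_mul_eq hm0 ((mul_comm _ _).trans (sum_Ico_char hm hν₂ hε₂).symm),
    digammaSum, digammaSum, div_mul_div_comm, div_mul_div_comm, Finset.sum_mul_sum,
    Finset.sum_mul_sum, Finset.sum_comm (s := Finset.Ico 1 m), mul_comm (m : ℂ), ← add_div,
    ← Finset.sum_add_distrib, Finset.sum_div]
  refine Finset.sum_congr rfl fun i _ ↦ ?_
  rw [← Finset.sum_add_distrib, Finset.sum_div]
  refine Finset.sum_congr rfl fun j _ ↦ ?_
  push_cast
  ring

lemma exists_rat_mul_two_pi_I {z : ℂ} {N : ℕ} (hN : 0 < N) (h : Complex.exp z ^ N = 1) :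
    ∃ r : ℚ, z = (r : ℂ) * (2 * (π : ℂ) * Complex.I) := by
  rw [← Complex.exp_nat_mul, Complex.exp_eq_one_iff] at h
  obtain ⟨k, hk⟩ := h
  have hN0 : (N : ℂ) ≠ 0 := by exact_mod_cast hN.ne'
  refine ⟨k / N, ?_⟩
  push_cast
  rw [div_mul_eq_mul_div, ← hk, mul_div_cancel_left₀ _ hN0]

theorem stmt13 (n m : ℕ) (hn : 2 ≤ n) (hm : 2 ≤ m) (ν₁ ν₂ ε₁ ε₂ : ℂ)
    (hν₁ : ν₁ ^ n = 1) (hν₁1 : ν₁ ≠ 1) (hν₂ : ν₂ ^ m = 1) (hν₂1 : ν₂ ≠ 1)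
    (hε₁ : ε₁ ^ n = 1) (hε₂ : ε₂ ^ m = 1) :
    ∃ r : ℚ,
      (∑ i ∈ Finset.Ico 1 n, ∑ j ∈ Finset.Ico 1 m,
          (1 - ν₁⁻¹ ^ i) * (1 - ν₂⁻¹ ^ j) * (ε₁ ^ i * ε₂ ^ j) / ((n : ℂ) * m) *
            ((2 * digamma 1 - digamma (1 - (i : ℝ) / n) - digamma (1 - (j : ℝ) / m) : ℝ) : ℂ))
        + (if (ε₁ = 1 ∧ ε₂ = 1) ∨ (ε₁ = ν₁ ∧ ε₂ = ν₂) then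
              -Complex.log ((n : ℂ) * m * (1 - ν₁) * (1 - ν₂))
            else if (ε₁ = 1 ∧ ε₂ = ν₂) ∨ (ε₁ = ν₁ ∧ ε₂ = 1) then
              Complex.log ((n : ℂ) * m * (1 - ν₁) * (1 - ν₂))
            else if ε₁ = 1 then Complex.log ((ε₂ - 1) / (ε₂ - ν₂))
            else if ε₂ = 1 then Complex.log ((ε₁ - 1) / (ε₁ - ν₁))
            else if ε₁ = ν₁ then -Complex.log ((ε₂ - 1) / (ε₂ - ν₂))
            else if ε₂ = ν₂ then -Complex.log ((ε₁ - 1) / (ε₁ - ν₁))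
            else 0)
      = (r : ℂ) * (2 * (π : ℂ) * Complex.I) := by
  have hn0 : 0 < n := by omega
  have hm0 : 0 < m := by omega
  have hnC : (n : ℂ) ≠ 0 := by exact_mod_cast hn0.ne'
  have hmC : (m : ℂ) ≠ 0 := by exact_mod_cast hm0.ne'
  have hν₁0 : ν₁ ≠ 0 := by
    rintro rfl
    simp [hn0.ne'] at hν₁
  have hν₂0 : ν₂ ≠ 0 := by
    rintro rfl
    simp [hm0.ne'] at hν₂
  have hd₁ : 1 - ν₁ ≠ 0 := sub_ne_zero.2 hν₁1.symm
  have hd₂ : 1 - ν₂ ≠ 0 := sub_ne_zero.2 hν₂1.symm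
  have hd₁' : ν₁ - 1 ≠ 0 := sub_ne_zero.2 hν₁1
  have hd₂' : ν₂ - 1 ≠ 0 := sub_ne_zero.2 hν₂1
  have hL : (n : ℂ) * m * (1 - ν₁) * (1 - ν₂) ≠ 0 := by positivity
  have hi₁ : 1 - ν₁⁻¹ = (ν₁ - 1) / ν₁ := by field_simp
  have hi₂ : 1 - ν₂⁻¹ = (ν₂ - 1) / ν₂ := by field_simp
  have p₁ : ν₁ ^ (2 * (n * m)) = 1 := by
    rw [show 2 * (n * m) = n * (2 * m) by ring, pow_mul, hν₁, one_pow]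
  have p₂ : ν₂ ^ (2 * (n * m)) = 1 := by
    rw [show 2 * (n * m) = m * (2 * n) by ring, pow_mul, hν₂, one_pow]
  have pneg : (-1 : ℂ) ^ (2 * (n * m)) = 1 := by simp [pow_mul]
  have hN : 0 < 2 * (n * m) := by positivity
  rw [double_digamma_sum_eq hn0 hm0 hν₁ hν₂ hε₁ hε₂]
  refine exists_rat_mul_two_pi_I hN ?_
  by_cases a1 : ε₁ = 1
  · subst a1
    have e₁ := exp_digammaSum_one hn0 hν₁ hν₁1
    by_cases b1 : ε₂ = 1
    · subst b1
      have e₂ := exp_digammaSum_one hm0 hν₂ hν₂1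
      simp only [hν₁1.symm, hν₂1.symm, and_self, true_or, if_true, if_false, sub_zero, one_mul]
      rw [Complex.exp_add, Complex.exp_add, Complex.exp_neg, e₁, e₂, Complex.exp_log hL]
      rw [show (n : ℂ) * (1 - ν₁) * (m * (1 - ν₂)) * (n * m * (1 - ν₁) * (1 - ν₂))⁻¹ = 1 by
        field_simp, one_pow]
    · by_cases b2 : ε₂ = ν₂
      · subst b2
        have e₂ := exp_digammaSum_self hm0 hν₂ hν₂1
        simp only [hν₁1.symm, hν₂1, and_false, false_and, or_false, and_self,
          if_true, if_false, sub_zero, one_mul, zero_sub, neg_mul]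
        rw [Complex.exp_add, Complex.exp_add, Complex.exp_neg, e₁, e₂, Complex.exp_log hL, hi₂]
        rw [show ((n : ℂ) * (1 - ν₁))⁻¹ * (m * ((ε₂ - 1) / ε₂))⁻¹ *
          (n * m * (1 - ν₁) * (1 - ε₂)) = -1 * ε₂ by field_simp; ring, mul_pow, pneg, p₂, one_mul]
      · have e₂ := exp_digammaSum_of_ne hm0 hν₂ hε₂ b1 b2
        have h1 := sub_ne_zero.2 b1
        have h2 := sub_ne_zero.2 b2
        simp only [hν₁1.symm, b1, b2, and_false, or_false,
          if_true, if_false, sub_zero, one_mul, zero_mul, zero_add]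
        rw [Complex.exp_add, e₂, Complex.exp_log (div_ne_zero h1 h2)]
        rw [show (ε₂ - ν₂) / (ε₂ - 1) * ((ε₂ - 1) / (ε₂ - ν₂)) = 1 by field_simp, one_pow]
  by_cases a2 : ε₁ = ν₁
  · subst a2
    have e₁ := exp_digammaSum_self hn0 hν₁ hν₁1
    by_cases b1 : ε₂ = 1
    · subst b1
      have e₂ := exp_digammaSum_one hm0 hν₂ hν₂1
      simp only [hν₁1, hν₂1.symm, and_false, false_and, or_false, false_or, and_self,
        if_true, if_false, sub_zero, one_mul, zero_sub, neg_mul]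
      rw [Complex.exp_add, Complex.exp_add, Complex.exp_neg, e₁, e₂, Complex.exp_log hL, hi₁]
      rw [show ((n : ℂ) * ((ε₁ - 1) / ε₁))⁻¹ * (m * (1 - ν₂))⁻¹ *
        (n * m * (1 - ε₁) * (1 - ν₂)) = -1 * ε₁ by field_simp; ring, mul_pow, pneg, p₁, one_mul]
    · by_cases b2 : ε₂ = ν₂
      · subst b2
        have e₂ := exp_digammaSum_self hm0 hν₂ hν₂1
        simp only [hν₁1, hν₂1, false_and, false_or, and_self,
          if_true, if_false, one_mul, zero_sub, neg_mul]
        rw [Complex.exp_add, Complex.exp_add, Complex.exp_neg, Complex.exp_neg, Complex.exp_neg,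
          e₁, e₂, Complex.exp_log hL, hi₁, hi₂]
        rw [show ((n : ℂ) * ((ε₁ - 1) / ε₁))⁻¹⁻¹ * (m * ((ε₂ - 1) / ε₂))⁻¹⁻¹ *
          (n * m * (1 - ε₁) * (1 - ε₂))⁻¹ = ε₁⁻¹ * ε₂⁻¹ by field_simp; ring, mul_pow, inv_pow,
          inv_pow, p₁, p₂, inv_one, one_mul]
      · have e₂ := exp_digammaSum_of_ne hm0 hν₂ hε₂ b1 b2
        have h1 := sub_ne_zero.2 b1
        have h2 := sub_ne_zero.2 b2
        simp only [hν₁1, b1, b2, and_false, or_false,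
          if_true, if_false, sub_zero, one_mul, zero_mul, zero_add, zero_sub, neg_mul]
        rw [Complex.exp_add, Complex.exp_neg, Complex.exp_neg, e₂,
          Complex.exp_log (div_ne_zero h1 h2)]
        rw [show ((ε₂ - ν₂) / (ε₂ - 1))⁻¹ * ((ε₂ - 1) / (ε₂ - ν₂))⁻¹ = 1 by field_simp, one_pow]
  have e₁ := exp_digammaSum_of_ne hn0 hν₁ hε₁ a1 a2
  have h1 := sub_ne_zero.2 a1
  have h2 := sub_ne_zero.2 a2
  by_cases b1 : ε₂ = 1
  · subst b1
    simp only [hν₂1.symm, a1, a2, false_and, or_false,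
      if_true, if_false, sub_zero, one_mul, zero_mul, add_zero]
    rw [Complex.exp_add, e₁, Complex.exp_log (div_ne_zero h1 h2)]
    rw [show (ε₁ - ν₁) / (ε₁ - 1) * ((ε₁ - 1) / (ε₁ - ν₁)) = 1 by field_simp, one_pow]
  by_cases b2 : ε₂ = ν₂
  · subst b2
    simp only [hν₂1, a1, a2, false_and, or_false,
      if_true, if_false, sub_zero, one_mul, zero_mul, add_zero, zero_sub, neg_mul]
    rw [Complex.exp_add, Complex.exp_neg, Complex.exp_neg, e₁,
      Complex.exp_log (div_ne_zero h1 h2)]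
    rw [show ((ε₁ - ν₁) / (ε₁ - 1))⁻¹ * ((ε₁ - 1) / (ε₁ - ν₁))⁻¹ = 1 by field_simp, one_pow]
  · simp [a1, a2, b1, b2]
end
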